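/- Let A be a weak bimonoid in a duoidal category (M,∘,I,•,J) in which idempotent morphisms split. Define ⊓̄^L_∘ := ((ϖ.(J∘(ε.μ)))•(J∘A)).ζ.(J∘A∘(Δ.η)) : J∘A → J∘A (where ζ : J∘A∘(A•A) → (J∘A∘A)•(J∘A)), an idempotent with fixed splitting ⊓̄^L_∘ = ῑ^L_∘.π̄^L_∘ through an object L̄_∘. Then: (i) ⊓^R_∘.⊓̄^L_∘ = ⊓^R_∘ and ⊓̄^L_∘.⊓^R_∘ = ⊓̄^L_∘; (ii) consequently π̄^L_∘.ι^R_∘ : R_∘ → L̄_∘ and π^R_∘.ῑ^L_∘ : L̄_∘ → R_∘ are mutually inverse isomorphisms; (iii) these isomorphisms are simultaneously morphisms of monoids and of comonoids in (M,•), where L̄_∘ carries the separable Frobenius monoid structure given by the •-reversed analogues of the formulas for R_∘, namely μ^{L̄_∘} = (ϖ•L̄_∘).((J∘ε)•L̄_∘).(ῑ^L_∘•L̄_∘).χ^R_{L̄_∘,L̄_∘}, η^{L̄_∘} = π̄^L_∘.(J∘η), Δ^{L̄_∘} = χ^R_{L̄_∘,L̄_∘}.(π̄^L_∘•L̄_∘).((J∘η)•L̄_∘),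 ε^{L̄_∘} = ϖ.(J∘ε).ῑ^L_∘, with L̄_∘ a right A-module via π̄^L_∘.(J∘μ).(ῑ^L_∘∘A). (The three symmetric variants obtained by the duoidal duality transformations hold analogously.) -/

import Mathlib

open CategoryTheory

universe v u

/-- A (strict) duoidal category structure on a category `M`: two strict monoidal
structures `co` (the first monoidal product `∘` with unit `uI`) and `bu` (the second
monoidal product `•` with unit `uJ`), together with the structure morphisms
`dlI : I ⟶ I • I`, `pw : J ∘ J ⟶ J`, `tau : I ⟶ J` and the interchange law `zt`,
subject to the axioms of a duoidal category. -/
structure Duo (M : Type u) [Category.{v} M] where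
  co : M → M → M
  coh : ∀ {X₁ Y₁ X₂ Y₂ : M}, (X₁ ⟶ Y₁) → (X₂ ⟶ Y₂) → (co X₁ X₂ ⟶ co Y₁ Y₂)
  uI : M
  bu : M → M → M
  buh : ∀ {X₁ Y₁ X₂ Y₂ : M}, (X₁ ⟶ Y₁) → (X₂ ⟶ Y₂) → (bu X₁ X₂ ⟶ bu Y₁ Y₂)
  uJ : M
  coA : ∀ X Y Z, co (co X Y) Z = co X (co Y Z)
  coL : ∀ X, co uI X = X
  coR : ∀ X, co X uI = X
  buA : ∀ X Y Z, bu (bu X Y) Z = bu X (bu Y Z)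
  buL : ∀ X, bu uJ X = X
  buR : ∀ X, bu X uJ = X
  coh_id : ∀ X Y, coh (𝟙 X) (𝟙 Y) = 𝟙 (co X Y)
  coh_comp : ∀ {X₁ Y₁ Z₁ X₂ Y₂ Z₂ : M} (f₁ : X₁ ⟶ Y₁) (g₁ : Y₁ ⟶ Z₁) (f₂ : X₂ ⟶ Y₂)
    (g₂ : Y₂ ⟶ Z₂), coh (f₁ ≫ g₁) (f₂ ≫ g₂) = coh f₁ f₂ ≫ coh g₁ g₂
  buh_id : ∀ X Y, buh (𝟙 X) (𝟙 Y) = 𝟙 (bu X Y)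
  buh_comp : ∀ {X₁ Y₁ Z₁ X₂ Y₂ Z₂ : M} (f₁ : X₁ ⟶ Y₁) (g₁ : Y₁ ⟶ Z₁) (f₂ : X₂ ⟶ Y₂)
    (g₂ : Y₂ ⟶ Z₂), buh (f₁ ≫ g₁) (f₂ ≫ g₂) = buh f₁ f₂ ≫ buh g₁ g₂
  coh_assoc : ∀ {X₁ Y₁ X₂ Y₂ X₃ Y₃ : M} (f₁ : X₁ ⟶ Y₁) (f₂ : X₂ ⟶ Y₂) (f₃ : X₃ ⟶ Y₃),
    coh (coh f₁ f₂) f₃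
      = eqToHom (coA X₁ X₂ X₃) ≫ coh f₁ (coh f₂ f₃) ≫ eqToHom (coA Y₁ Y₂ Y₃).symm
  coh_unitL : ∀ {X Y : M} (f : X ⟶ Y),
    coh (𝟙 uI) f = eqToHom (coL X) ≫ f ≫ eqToHom (coL Y).symm
  coh_unitR : ∀ {X Y : M} (f : X ⟶ Y),
    coh f (𝟙 uI) = eqToHom (coR X) ≫ f ≫ eqToHom (coR Y).symm
  buh_assoc : ∀ {X₁ Y₁ X₂ Y₂ X₃ Y₃ : M} (f₁ : X₁ ⟶ Y₁) (f₂ : X₂ ⟶ Y₂) (f₃ : X₃ ⟶ Y₃),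
    buh (buh f₁ f₂) f₃
      = eqToHom (buA X₁ X₂ X₃) ≫ buh f₁ (buh f₂ f₃) ≫ eqToHom (buA Y₁ Y₂ Y₃).symm
  buh_unitL : ∀ {X Y : M} (f : X ⟶ Y),
    buh (𝟙 uJ) f = eqToHom (buL X) ≫ f ≫ eqToHom (buL Y).symm
  buh_unitR : ∀ {X Y : M} (f : X ⟶ Y),
    buh f (𝟙 uJ) = eqToHom (buR X) ≫ f ≫ eqToHom (buR Y).symm
  dlI : uI ⟶ bu uI uI
  pw : co uJ uJ ⟶ uJ
  tau : uI ⟶ uJ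
  zt : ∀ A B C D : M, co (bu A B) (bu C D) ⟶ bu (co A C) (co B D)
  zt_nat : ∀ {A A' B B' C C' D D' : M} (f : A ⟶ A') (g : B ⟶ B') (h : C ⟶ C')
    (k : D ⟶ D'),
    coh (buh f g) (buh h k) ≫ zt A' B' C' D' = zt A B C D ≫ buh (coh f h) (coh g k)
  pw_assoc : coh pw (𝟙 uJ) ≫ pw = eqToHom (coA uJ uJ uJ) ≫ coh (𝟙 uJ) pw ≫ pw
  pw_unitL : eqToHom (coL uJ).symm ≫ coh tau (𝟙 uJ) ≫ pw = 𝟙 uJ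
  pw_unitR : eqToHom (coR uJ).symm ≫ coh (𝟙 uJ) tau ≫ pw = 𝟙 uJ
  dlI_coassoc : dlI ≫ buh dlI (𝟙 uI) ≫ eqToHom (buA uI uI uI) = dlI ≫ buh (𝟙 uI) dlI
  dlI_counitL : dlI ≫ buh tau (𝟙 uI) ≫ eqToHom (buL uI) = 𝟙 uI
  dlI_counitR : dlI ≫ buh (𝟙 uI) tau ≫ eqToHom (buR uI) = 𝟙 uI
  zt_assoc1 : ∀ A B C D E F : M,
    coh (zt A B C D) (𝟙 (bu E F)) ≫ zt (co A C) (co B D) E F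
      = eqToHom (coA (bu A B) (bu C D) (bu E F)) ≫ coh (𝟙 (bu A B)) (zt C D E F)
          ≫ zt A B (co C E) (co D F)
          ≫ eqToHom (show bu (co A (co C E)) (co B (co D F))
              = bu (co (co A C) E) (co (co B D) F) by simp [coA])
  zt_assoc2 : ∀ A B C D E F : M,
    zt (bu A B) C (bu D E) F ≫ buh (zt A B D E) (𝟙 (co C F))
      = eqToHom (show co (bu (bu A B) C) (bu (bu D E) F)
            = co (bu A (bu B C)) (bu D (bu E F)) by simp [buA])
          ≫ zt A (bu B C) D (bu E F) ≫ buh (𝟙 (co A D)) (zt B C E F)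
          ≫ eqToHom (buA (co A D) (co B E) (co C F)).symm
  zt_unitA : ∀ A B : M,
    eqToHom (coL (bu A B)).symm ≫ coh dlI (𝟙 (bu A B)) ≫ zt uI uI A B
      ≫ eqToHom (show bu (co uI A) (co uI B) = bu A B by simp [coL]) = 𝟙 (bu A B)
  zt_unitB : ∀ A B : M,
    eqToHom (coR (bu A B)).symm ≫ coh (𝟙 (bu A B)) dlI ≫ zt A B uI uI
      ≫ eqToHom (show bu (co A uI) (co B uI) = bu A B by simp [coR]) = 𝟙 (bu A B)
  zt_unitC : ∀ A B : M,
    eqToHom (show co A B = co (bu uJ A) (bu uJ B) by simp [buL]) ≫ zt uJ A uJ B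
      ≫ buh pw (𝟙 (co A B)) ≫ eqToHom (buL (co A B)) = 𝟙 (co A B)
  zt_unitD : ∀ A B : M,
    eqToHom (show co A B = co (bu A uJ) (bu B uJ) by simp [buR]) ≫ zt A uJ B uJ
      ≫ buh (𝟙 (co A B)) pw ≫ eqToHom (buR (co A B)) = 𝟙 (co A B)

namespace Duo

variable {M : Type u} [Category.{v} M] (D : Duo M)

/-- Axiom (WB): the multiplication is comultiplicative. -/
def WBeq (A : M) (mu : D.co A A ⟶ A) (dl : A ⟶ D.bu A A) : Prop :=
  mu ≫ dl = D.coh dl dl ≫ D.zt A A A A ≫ D.buh mu mu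

/-- Axiom (RRU). -/
def RRUeq (A : M) (mu : D.co A A ⟶ A) (eta : D.uI ⟶ A) (dl : A ⟶ D.bu A A) : Prop :=
  D.dlI ≫ D.buh (𝟙 D.uI) (eta ≫ dl)
    ≫ eqToHom (show D.bu D.uI (D.bu A A) = D.bu (D.co (D.bu D.uI A) D.uI) A by
        simp [D.coR, D.buA])
    ≫ D.buh (D.coh (𝟙 (D.bu D.uI A)) D.dlI) (𝟙 A)
    ≫ D.buh (D.coh (𝟙 (D.bu D.uI A)) (D.buh (𝟙 D.uI) (eta ≫ dl))) (𝟙 A)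
    ≫ eqToHom (show D.bu (D.co (D.bu D.uI A) (D.bu D.uI (D.bu A A))) A
        = D.bu (D.co (D.bu D.uI A) (D.bu (D.bu D.uI A) A)) A by simp [D.buA])
    ≫ D.buh (D.zt D.uI A (D.bu D.uI A) A) (𝟙 A)
    ≫ eqToHom (show D.bu (D.bu (D.co D.uI (D.bu D.uI A)) (D.co A A)) A
        = D.bu (D.bu (D.bu D.uI A) (D.co A A)) A by simp [D.coL])
    ≫ D.buh (D.buh (𝟙 (D.bu D.uI A)) mu) (𝟙 A)
  = D.dlI ≫ D.buh (𝟙 D.uI) eta ≫ D.buh (𝟙 D.uI) dl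
    ≫ eqToHom (show D.bu D.uI (D.bu A A) = D.bu (D.bu D.uI A) A by simp [D.buA])
    ≫ D.buh (𝟙 (D.bu D.uI A)) dl
    ≫ eqToHom (show D.bu (D.bu D.uI A) (D.bu A A)
        = D.bu (D.bu (D.bu D.uI A) A) A by simp [D.buA])

/-- Axiom (LRU). -/
def LRUeq (A : M) (mu : D.co A A ⟶ A) (eta : D.uI ⟶ A) (dl : A ⟶ D.bu A A) : Prop :=
  D.dlI ≫ D.buh (eta ≫ dl) (𝟙 D.uI)
    ≫ eqToHom (show D.bu (D.bu A A) D.uI = D.bu A (D.co (D.bu A D.uI) D.uI) by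
        simp [D.coR, D.buA])
    ≫ D.buh (𝟙 A) (D.coh (𝟙 (D.bu A D.uI)) D.dlI)
    ≫ D.buh (𝟙 A) (D.coh (𝟙 (D.bu A D.uI)) (D.buh (eta ≫ dl) (𝟙 D.uI)))
    ≫ eqToHom (show D.bu A (D.co (D.bu A D.uI) (D.bu (D.bu A A) D.uI))
        = D.bu A (D.co (D.bu A D.uI) (D.bu A (D.bu A D.uI))) by simp [D.buA])
    ≫ D.buh (𝟙 A) (D.zt A D.uI A (D.bu A D.uI))
    ≫ eqToHom (show D.bu A (D.bu (D.co A A) (D.co D.uI (D.bu A D.uI)))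
        = D.bu (D.bu (D.bu A (D.co A A)) A) D.uI by simp [D.coL, D.buA])
    ≫ D.buh (D.buh (D.buh (𝟙 A) mu) (𝟙 A)) (𝟙 D.uI)
  = D.dlI ≫ D.buh eta (𝟙 D.uI) ≫ D.buh dl (𝟙 D.uI) ≫ D.buh (D.buh dl (𝟙 A)) (𝟙 D.uI)

/-- Axiom (LRC). -/
def LRCeq (A : M) (mu : D.co A A ⟶ A) (dl : A ⟶ D.bu A A) (ep : A ⟶ D.uJ) : Prop :=
  D.coh (D.coh (𝟙 (D.co D.uJ A)) dl) (𝟙 A)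
    ≫ eqToHom (show D.co (D.co (D.co D.uJ A) (D.bu A A)) A
        = D.co (D.co (D.bu (D.co D.uJ A) D.uJ) (D.bu A A)) A by simp [D.buR])
    ≫ D.coh (D.zt (D.co D.uJ A) D.uJ A A) (𝟙 A)
    ≫ D.coh (D.buh (eqToHom (D.coA D.uJ A A) ≫ D.coh (𝟙 D.uJ) (mu ≫ ep))
        (𝟙 (D.co D.uJ A))) (𝟙 A)
    ≫ D.coh (D.buh D.pw (𝟙 (D.co D.uJ A))) (𝟙 A)
    ≫ eqToHom (show D.co (D.bu D.uJ (D.co D.uJ A)) A = D.co D.uJ (D.co A A) by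
        simp [D.buL, D.coA])
    ≫ D.coh (𝟙 D.uJ) (mu ≫ ep) ≫ D.pw
  = eqToHom (show D.co (D.co (D.co D.uJ A) A) A = D.co (D.co D.uJ A) (D.co A A) by
        simp [D.coA])
    ≫ D.coh (𝟙 (D.co D.uJ A)) mu
    ≫ eqToHom (D.coA D.uJ A A)
    ≫ D.coh (𝟙 D.uJ) mu ≫ D.coh (𝟙 D.uJ) ep ≫ D.pw

/-- Axiom (LLC). -/
def LLCeq (A : M) (mu : D.co A A ⟶ A) (dl : A ⟶ D.bu A A) (ep : A ⟶ D.uJ) : Prop :=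
  D.coh (D.coh (𝟙 (D.co D.uJ A)) dl) (𝟙 A)
    ≫ eqToHom (show D.co (D.co (D.co D.uJ A) (D.bu A A)) A
        = D.co (D.co (D.bu D.uJ (D.co D.uJ A)) (D.bu A A)) A by simp [D.buL])
    ≫ D.coh (D.zt D.uJ (D.co D.uJ A) A A) (𝟙 A)
    ≫ D.coh (D.buh (𝟙 (D.co D.uJ A))
        (eqToHom (D.coA D.uJ A A) ≫ D.coh (𝟙 D.uJ) (mu ≫ ep))) (𝟙 A)
    ≫ D.coh (D.buh (𝟙 (D.co D.uJ A)) D.pw) (𝟙 A)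
    ≫ eqToHom (show D.co (D.bu (D.co D.uJ A) D.uJ) A = D.co D.uJ (D.co A A) by
        simp [D.buR, D.coA])
    ≫ D.coh (𝟙 D.uJ) (mu ≫ ep) ≫ D.pw
  = eqToHom (show D.co (D.co (D.co D.uJ A) A) A = D.co (D.co D.uJ A) (D.co A A) by
        simp [D.coA])
    ≫ D.coh (𝟙 (D.co D.uJ A)) mu
    ≫ eqToHom (D.coA D.uJ A A)
    ≫ D.coh (𝟙 D.uJ) mu ≫ D.coh (𝟙 D.uJ) ep ≫ D.pw

/-- Axiom (RLU), obtained from (RRU) by replacing `∘` by its opposite. -/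
def RLUeq (A : M) (mu : D.co A A ⟶ A) (eta : D.uI ⟶ A) (dl : A ⟶ D.bu A A) : Prop :=
  D.dlI ≫ D.buh (𝟙 D.uI) (eta ≫ dl)
    ≫ eqToHom (show D.bu D.uI (D.bu A A) = D.bu (D.co D.uI (D.bu D.uI A)) A by
        simp [D.coL, D.buA])
    ≫ D.buh (D.coh D.dlI (𝟙 (D.bu D.uI A))) (𝟙 A)
    ≫ D.buh (D.coh (D.buh (𝟙 D.uI) (eta ≫ dl)) (𝟙 (D.bu D.uI A))) (𝟙 A)
    ≫ eqToHom (show D.bu (D.co (D.bu D.uI (D.bu A A)) (D.bu D.uI A)) A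
        = D.bu (D.co (D.bu (D.bu D.uI A) A) (D.bu D.uI A)) A by simp [D.buA])
    ≫ D.buh (D.zt (D.bu D.uI A) A D.uI A) (𝟙 A)
    ≫ eqToHom (show D.bu (D.bu (D.co (D.bu D.uI A) D.uI) (D.co A A)) A
        = D.bu (D.bu (D.bu D.uI A) (D.co A A)) A by simp [D.coR])
    ≫ D.buh (D.buh (𝟙 (D.bu D.uI A)) mu) (𝟙 A)
  = D.dlI ≫ D.buh (𝟙 D.uI) eta ≫ D.buh (𝟙 D.uI) dl
    ≫ eqToHom (show D.bu D.uI (D.bu A A) = D.bu (D.bu D.uI A) A by simp [D.buA])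
    ≫ D.buh (𝟙 (D.bu D.uI A)) dl
    ≫ eqToHom (show D.bu (D.bu D.uI A) (D.bu A A)
        = D.bu (D.bu (D.bu D.uI A) A) A by simp [D.buA])

/-- Axiom (LLU), obtained from (LRU) by replacing `∘` by its opposite. -/
def LLUeq (A : M) (mu : D.co A A ⟶ A) (eta : D.uI ⟶ A) (dl : A ⟶ D.bu A A) : Prop :=
  D.dlI ≫ D.buh (eta ≫ dl) (𝟙 D.uI)
    ≫ eqToHom (show D.bu (D.bu A A) D.uI = D.bu A (D.co D.uI (D.bu A D.uI)) by
        simp [D.coL, D.buA])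
    ≫ D.buh (𝟙 A) (D.coh D.dlI (𝟙 (D.bu A D.uI)))
    ≫ D.buh (𝟙 A) (D.coh (D.buh (eta ≫ dl) (𝟙 D.uI)) (𝟙 (D.bu A D.uI)))
    ≫ eqToHom (show D.bu A (D.co (D.bu (D.bu A A) D.uI) (D.bu A D.uI))
        = D.bu A (D.co (D.bu A (D.bu A D.uI)) (D.bu A D.uI)) by simp [D.buA])
    ≫ D.buh (𝟙 A) (D.zt A (D.bu A D.uI) A D.uI)
    ≫ eqToHom (show D.bu A (D.bu (D.co A A) (D.co (D.bu A D.uI) D.uI))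
        = D.bu (D.bu (D.bu A (D.co A A)) A) D.uI by simp [D.coR, D.buA])
    ≫ D.buh (D.buh (D.buh (𝟙 A) mu) (𝟙 A)) (𝟙 D.uI)
  = D.dlI ≫ D.buh eta (𝟙 D.uI) ≫ D.buh dl (𝟙 D.uI) ≫ D.buh (D.buh dl (𝟙 A)) (𝟙 D.uI)

/-- Axiom (RRC), obtained from (LLC) by replacing `∘` by its opposite. -/
def RRCeq (A : M) (mu : D.co A A ⟶ A) (dl : A ⟶ D.bu A A) (ep : A ⟶ D.uJ) : Prop :=
  D.coh (D.coh (D.coh (𝟙 A) dl) (𝟙 A)) (𝟙 D.uJ)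
    ≫ eqToHom (show D.co (D.co (D.co A (D.bu A A)) A) D.uJ
        = D.co A (D.co (D.bu A A) (D.bu (D.co A D.uJ) D.uJ)) by simp [D.coA, D.buR])
    ≫ D.coh (𝟙 A) (D.zt A A (D.co A D.uJ) D.uJ)
    ≫ D.coh (𝟙 A) (D.buh (eqToHom (D.coA A A D.uJ).symm ≫ D.coh (mu ≫ ep) (𝟙 D.uJ))
        (𝟙 (D.co A D.uJ)))
    ≫ D.coh (𝟙 A) (D.buh D.pw (𝟙 (D.co A D.uJ)))
    ≫ eqToHom (show D.co A (D.bu D.uJ (D.co A D.uJ)) = D.co (D.co A A) D.uJ by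
        simp [D.buL, D.coA])
    ≫ D.coh (mu ≫ ep) (𝟙 D.uJ) ≫ D.pw
  = D.coh (D.coh mu (𝟙 A)) (𝟙 D.uJ) ≫ D.coh mu (𝟙 D.uJ) ≫ D.coh ep (𝟙 D.uJ) ≫ D.pw

/-- Axiom (RLC), obtained from (LRC) by replacing `∘` by its opposite. -/
def RLCeq (A : M) (mu : D.co A A ⟶ A) (dl : A ⟶ D.bu A A) (ep : A ⟶ D.uJ) : Prop :=
  D.coh (D.coh (D.coh (𝟙 A) dl) (𝟙 A)) (𝟙 D.uJ)
    ≫ eqToHom (show D.co (D.co (D.co A (D.bu A A)) A) D.uJ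
        = D.co A (D.co (D.bu A A) (D.bu D.uJ (D.co A D.uJ))) by simp [D.coA, D.buL])
    ≫ D.coh (𝟙 A) (D.zt A A D.uJ (D.co A D.uJ))
    ≫ D.coh (𝟙 A) (D.buh (𝟙 (D.co A D.uJ))
        (eqToHom (D.coA A A D.uJ).symm ≫ D.coh (mu ≫ ep) (𝟙 D.uJ)))
    ≫ D.coh (𝟙 A) (D.buh (𝟙 (D.co A D.uJ)) D.pw)
    ≫ eqToHom (show D.co A (D.bu (D.co A D.uJ) D.uJ) = D.co (D.co A A) D.uJ by
        simp [D.buR, D.coA])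
    ≫ D.coh (mu ≫ ep) (𝟙 D.uJ) ≫ D.pw
  = D.coh (D.coh mu (𝟙 A)) (𝟙 D.uJ) ≫ D.coh mu (𝟙 D.uJ) ≫ D.coh ep (𝟙 D.uJ) ≫ D.pw

end Duo

/-- A right weak bimonoid in a duoidal category. -/
structure RWB {M : Type u} [Category.{v} M] (D : Duo M) where
  A : M
  mu : D.co A A ⟶ A
  eta : D.uI ⟶ A
  dl : A ⟶ D.bu A A
  ep : A ⟶ D.uJ
  mu_assoc : D.coh mu (𝟙 A) ≫ mu = eqToHom (D.coA A A A) ≫ D.coh (𝟙 A) mu ≫ mu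
  mu_unitL : eqToHom (D.coL A).symm ≫ D.coh eta (𝟙 A) ≫ mu = 𝟙 A
  mu_unitR : eqToHom (D.coR A).symm ≫ D.coh (𝟙 A) eta ≫ mu = 𝟙 A
  dl_coassoc : dl ≫ D.buh dl (𝟙 A) ≫ eqToHom (D.buA A A A) = dl ≫ D.buh (𝟙 A) dl
  dl_counitL : dl ≫ D.buh ep (𝟙 A) ≫ eqToHom (D.buL A) = 𝟙 A
  dl_counitR : dl ≫ D.buh (𝟙 A) ep ≫ eqToHom (D.buR A) = 𝟙 A
  wb : D.WBeq A mu dl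
  rru : D.RRUeq A mu eta dl
  lru : D.LRUeq A mu eta dl
  lrc : D.LRCeq A mu dl ep
  llc : D.LLCeq A mu dl ep

/-- A weak bimonoid: both a right weak bimonoid and a left weak bimonoid. -/
structure WBim {M : Type u} [Category.{v} M] (D : Duo M) extends RWB D where
  rlu : D.RLUeq A mu eta dl
  llu : D.LLUeq A mu eta dl
  rlc : D.RLCeq A mu dl ep
  rrc : D.RRCeq A mu dl ep

/-- Idempotent morphisms split in `M`. -/
def SplitIdem (M : Type u) [Category.{v} M] : Prop :=
  ∀ ⦃X : M⦄ (e : X ⟶ X), e ≫ e = e →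
    ∃ (Y : M) (p : X ⟶ Y) (i : Y ⟶ X), p ≫ i = e ∧ i ≫ p = 𝟙 Y

namespace RWB

variable {M : Type u} [Category.{v} M] {D : Duo M} (W : RWB D)

/-- The object `J∘A`. -/
def JA : M := D.co D.uJ W.A

/-- The idempotent morphism `⊓^R_∘ :=
((J∘A)•ϖ).((J∘A)•(J∘(ε.μ))).ζ.(J∘A∘(Δ.η)) : J∘A ⟶ J∘A`. -/
def sqcapR : W.JA ⟶ W.JA :=
  eqToHom (show W.JA = D.co W.JA D.uI by simp [D.coR])
    ≫ D.coh (𝟙 W.JA) (W.eta ≫ W.dl)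
    ≫ eqToHom (show D.co W.JA (D.bu W.A W.A)
        = D.co (D.bu D.uJ W.JA) (D.bu W.A W.A) by simp [D.buL])
    ≫ D.zt D.uJ W.JA W.A W.A
    ≫ D.buh (𝟙 W.JA) (eqToHom (D.coA D.uJ W.A W.A) ≫ D.coh (𝟙 D.uJ) (W.mu ≫ W.ep))
    ≫ D.buh (𝟙 W.JA) D.pw
    ≫ eqToHom (D.buR W.JA)

/-- The natural idempotent `χ^R_{F,G} = (φ•γ).ζ.((F•G)∘(Δ.η))` on `F•G`, for right
`A`-modules `(F,f)` and `(G,g)`. -/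
def chiR (F G : M) (f : D.co F W.A ⟶ F) (g : D.co G W.A ⟶ G) :
    D.bu F G ⟶ D.bu F G :=
  eqToHom (show D.bu F G = D.co (D.bu F G) D.uI by simp [D.coR])
    ≫ D.coh (𝟙 (D.bu F G)) (W.eta ≫ W.dl)
    ≫ D.zt F G W.A W.A
    ≫ D.buh f g

/-- The morphism `J∘η : J ⟶ J∘A`. -/
def jeta : D.uJ ⟶ W.JA :=
  eqToHom (D.coR D.uJ).symm ≫ D.coh (𝟙 D.uJ) W.eta

/-- The morphism `(π^R_∘).(τ∘A) : A ⟶ R_∘` needs `τ∘A : A ⟶ J∘A`. -/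
def tauA : W.A ⟶ W.JA :=
  eqToHom (D.coL W.A).symm ≫ D.coh D.tau (𝟙 W.A)

section Retract

variable (R : M) (p : W.JA ⟶ R) (i : R ⟶ W.JA)

/-- The right `A`-action `γ_A = π^R_∘.(J∘μ).(ι^R_∘ ∘ A)` on the retract `R_∘`. -/
def gamA : D.co R W.A ⟶ R :=
  D.coh i (𝟙 W.A) ≫ eqToHom (D.coA D.uJ W.A W.A) ≫ D.coh (𝟙 D.uJ) W.mu ≫ p

/-- The left `J`-action `γ_J = π^R_∘.(ϖ∘A).(J∘ι^R_∘)` on the retract `R_∘`. -/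
def gamJ : D.co D.uJ R ⟶ R :=
  D.coh (𝟙 D.uJ) i ≫ eqToHom (D.coA D.uJ D.uJ W.A).symm ≫ D.coh D.pw (𝟙 W.A) ≫ p

/-- The multiplication `μ^R_∘ = (R∘•ϖ).(R∘•(J∘ε)).(R∘•ι^R_∘).χ^R_{R∘,R∘}`. -/
def muR : D.bu R R ⟶ R :=
  W.chiR R R (W.gamA R p i) (W.gamA R p i)
    ≫ D.buh (𝟙 R) i
    ≫ D.buh (𝟙 R) (D.coh (𝟙 D.uJ) W.ep)
    ≫ D.buh (𝟙 R) D.pw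
    ≫ eqToHom (D.buR R)

/-- The unit `η^R_∘ = π^R_∘.(J∘η)`. -/
def etaR : D.uJ ⟶ R := W.jeta ≫ p

/-- The comultiplication `Δ^R_∘ = χ^R_{R∘,R∘}.(R∘•π^R_∘).(R∘•(J∘η))`. -/
def DeltaR : R ⟶ D.bu R R :=
  eqToHom (D.buR R).symm
    ≫ D.buh (𝟙 R) W.jeta
    ≫ D.buh (𝟙 R) p
    ≫ W.chiR R R (W.gamA R p i) (W.gamA R p i)

/-- The counit `ε^R_∘ = ϖ.(J∘ε).ι^R_∘`. -/
def epsR : R ⟶ D.uJ := i ≫ D.coh (𝟙 D.uJ) W.ep ≫ D.pw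

end Retract

/-- The comultiplication-type morphism `ζ.(J∘Δ) : J∘A ⟶ (J∘A)•(J∘A)`. -/
def coact0 : W.JA ⟶ D.bu W.JA W.JA :=
  D.coh (𝟙 D.uJ) W.dl
    ≫ eqToHom (show D.co D.uJ (D.bu W.A W.A)
        = D.co (D.bu D.uJ D.uJ) (D.bu W.A W.A) by simp [D.buL])
    ≫ D.zt D.uJ D.uJ W.A W.A

end RWB

namespace RWB

variable {M : Type u} [Category.{v} M] {D : Duo M} (W : RWB D)

/-- The idempotent `⊓̄^L_∘ := ((ϖ.(J∘(ε.μ)))•(J∘A)).ζ.(J∘A∘(Δ.η)) : J∘A ⟶ J∘A`. -/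
def sqcapLbar : W.JA ⟶ W.JA :=
  eqToHom (show W.JA = D.co W.JA D.uI by simp [D.coR])
    ≫ D.coh (𝟙 W.JA) (W.eta ≫ W.dl)
    ≫ eqToHom (show D.co W.JA (D.bu W.A W.A)
        = D.co (D.bu W.JA D.uJ) (D.bu W.A W.A) by simp [D.buR])
    ≫ D.zt W.JA D.uJ W.A W.A
    ≫ D.buh (eqToHom (D.coA D.uJ W.A W.A) ≫ D.coh (𝟙 D.uJ) (W.mu ≫ W.ep) ≫ D.pw)
        (𝟙 W.JA)
    ≫ eqToHom (D.buL W.JA)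

end RWB

/-- If `e.f` (in diagrammatic order) equals `f`, for split idempotents `e = p.i` and
`f = q.j`, then `p.i.q = q`. -/
lemma comp_splitting_of_comp {M : Type u} [Category.{v} M] {X R L : M} {p : X ⟶ R} {i : R ⟶ X}
    {q : X ⟶ L} {j : L ⟶ X} {e f : X ⟶ X} (hpi : p ≫ i = e) (hqj : q ≫ j = f)
    (hjq : j ≫ q = 𝟙 L) (h : e ≫ f = f) : p ≫ i ≫ q = q := by
  rw [← Category.assoc, hpi, ← Category.comp_id q, ← hjq, ← Category.assoc q, hqj,
    ← Category.assoc, h]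

/-- Morphisms of `M` with their endpoints bundled, together with a formal zero morphism
between any two objects.  Composition, `∘` and `•` become total operations on this type, and
the strict associativity and unitality constraints become equations without transports. -/
structure Ar {M : Type u} [Category.{v} M] (D : Duo M) where
  dom : M
  cod : M
  hom : Option (dom ⟶ cod)

namespace Ar

variable {M : Type u} [Category.{v} M] {D : Duo M}

/-- The bundled form of a morphism. -/
def of (D : Duo M) {X Y : M} (f : X ⟶ Y) : Ar D := ⟨X, Y, some f⟩

/-- The bundled identity morphism. -/
def one (D : Duo M) (X : M) : Ar D := of D (𝟙 X)

open Classical in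
/-- Diagrammatic composition, equal to the zero morphism when the endpoints do not match. -/
noncomputable def seq (f g : Ar D) : Ar D :=
  ⟨f.dom, g.cod, if h : f.cod = g.dom then
    f.hom.bind fun a => g.hom.map fun b => a ≫ eqToHom h ≫ b else none⟩

/-- The monoidal product `∘` of bundled morphisms. -/
def o (f g : Ar D) : Ar D :=
  ⟨D.co f.dom g.dom, D.co f.cod g.cod, f.hom.bind fun a => g.hom.map fun b => D.coh a b⟩

/-- The monoidal product `•` of bundled morphisms. -/
def b (f g : Ar D) : Ar D :=
  ⟨D.bu f.dom g.dom, D.bu f.cod g.cod, f.hom.bind fun a => g.hom.map fun b => D.buh a b⟩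

/-- The bundled interchange morphism. -/
def z (D : Duo M) (X Y Z W : M) : Ar D := of D (D.zt X Y Z W)

end Ar

local infixr:70 " ⨾ " => Ar.seq
local infixr:80 " ⊚ " => Ar.o
local infixr:80 " ⊡ " => Ar.b

namespace Ar

variable {M : Type u} [Category.{v} M] {D : Duo M}

@[simp] lemma of_dom {X Y : M} (f : X ⟶ Y) : (of D f).dom = X := (rfl)
@[simp] lemma of_cod {X Y : M} (f : X ⟶ Y) : (of D f).cod = Y := (rfl)
@[simp] lemma one_dom (X : M) : (one D X).dom = X := (rfl)
@[simp] lemma one_cod (X : M) : (one D X).cod = X := (rfl)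
@[simp] lemma seq_dom (f g : Ar D) : (f ⨾ g).dom = f.dom := (rfl)
@[simp] lemma seq_cod (f g : Ar D) : (f ⨾ g).cod = g.cod := (rfl)
@[simp] lemma o_dom (f g : Ar D) : (f ⊚ g).dom = D.co f.dom g.dom := (rfl)
@[simp] lemma o_cod (f g : Ar D) : (f ⊚ g).cod = D.co f.cod g.cod := (rfl)
@[simp] lemma b_dom (f g : Ar D) : (f ⊡ g).dom = D.bu f.dom g.dom := (rfl)
@[simp] lemma b_cod (f g : Ar D) : (f ⊡ g).cod = D.bu f.cod g.cod := (rfl)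
@[simp] lemma z_dom (X Y Z W : M) :
    (z D X Y Z W).dom = D.co (D.bu X Y) (D.bu Z W) := (rfl)
@[simp] lemma z_cod (X Y Z W : M) :
    (z D X Y Z W).cod = D.bu (D.co X Z) (D.co Y W) := (rfl)

lemma of_injective {X Y : M} {f g : X ⟶ Y} (h : of D f = of D g) : f = g := by
  simpa [of] using h

lemma mk_none {X Y X' Y' : M} (h : X = X') (h' : Y = Y') :
    (⟨X, Y, none⟩ : Ar D) = ⟨X', Y', none⟩ := by
  subst h h'; rfl

lemma of_eq_of {X Y X' Y' : M} (f : X ⟶ Y) (g : X' ⟶ Y') (h : X = X') (h' : Y' = Y)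
    (e : f = eqToHom h ≫ g ≫ eqToHom h') : of D f = of D g := by
  subst h h'; simp [e]

lemma of_comp {X Y Z : M} (f : X ⟶ Y) (g : Y ⟶ Z) : of D (f ≫ g) = of D f ⨾ of D g := by
  have h : f ≫ g = f ≫ eqToHom (rfl : Y = Y) ≫ g := by simp
  rw [h, seq]
  refine congrArg (mk X Z) ?_
  rw [dif_pos (show (of D f).cod = (of D g).dom from rfl)]
  rfl

lemma of_eqToHom_comp {X Y Z : M} (h : X = Y) (f : Y ⟶ Z) :
    of D (eqToHom h ≫ f) = of D f := by
  subst h; simp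

lemma of_comp_eqToHom {X Y Z : M} (f : X ⟶ Y) (h : Y = Z) :
    of D (f ≫ eqToHom h) = of D f := by
  subst h; simp

lemma of_coh {X Y X' Y' : M} (f : X ⟶ Y) (g : X' ⟶ Y') :
    of D (D.coh f g) = of D f ⊚ of D g := rfl

lemma of_buh {X Y X' Y' : M} (f : X ⟶ Y) (g : X' ⟶ Y') :
    of D (D.buh f g) = of D f ⊡ of D g := rfl

lemma of_id (X : M) : of D (𝟙 X) = one D X := rfl

lemma of_zt (X Y Z W : M) : of D (D.zt X Y Z W) = z D X Y Z W := rfl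

lemma one_co (X Y : M) : one D (D.co X Y) = one D X ⊚ one D Y := by
  simp only [one, ← of_coh, D.coh_id]

lemma one_bu (X Y : M) : one D (D.bu X Y) = one D X ⊡ one D Y := by
  simp only [one, ← of_buh, D.buh_id]

lemma seq_seq (f g h : Ar D) : (f ⨾ g) ⨾ h = f ⨾ g ⨾ h := by
  obtain ⟨X, Y, f⟩ := f
  obtain ⟨Y', Z, g⟩ := g
  obtain ⟨Z', W, h⟩ := h
  by_cases e : Y = Y' <;> by_cases e' : Z = Z' <;>
    rcases f with _ | f <;> rcases g with _ | g <;> rcases h with _ | h <;> simp [seq, e, e']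

lemma one_seq (X : M) (f : Ar D) (h : f.dom = X) : one D X ⨾ f = f := by
  obtain ⟨X, Y, f⟩ := f
  subst h
  rcases f with _ | f
  · simp [seq, one, of]
  · exact (of_comp _ _).symm.trans (by rw [Category.id_comp]; rfl)

lemma seq_one (X : M) (f : Ar D) (h : f.cod = X) : f ⨾ one D X = f := by
  obtain ⟨X, Y, f⟩ := f
  subst h
  rcases f with _ | f
  · simp [seq, one, of]
  · exact (of_comp _ _).symm.trans (by rw [Category.comp_id]; rfl)

lemma o_seq {f g h k : Ar D} (e : f.cod = g.dom) (e' : h.cod = k.dom) :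
    (f ⨾ g) ⊚ (h ⨾ k) = (f ⊚ h) ⨾ (g ⊚ k) := by
  obtain ⟨X, Y, f⟩ := f
  obtain ⟨Y', Z, g⟩ := g
  obtain ⟨X₂, Y₂, h⟩ := h
  obtain ⟨Y₂', Z₂, k⟩ := k
  dsimp only at e e'
  subst e e'
  rcases f with _ | f <;> rcases g with _ | g <;> rcases h with _ | h <;> rcases k with _ | k <;>
    simp [seq, o, D.coh_comp]

lemma b_seq {f g h k : Ar D} (e : f.cod = g.dom) (e' : h.cod = k.dom) :
    (f ⨾ g) ⊡ (h ⨾ k) = (f ⊡ h) ⨾ (g ⊡ k) := by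
  obtain ⟨X, Y, f⟩ := f
  obtain ⟨Y', Z, g⟩ := g
  obtain ⟨X₂, Y₂, h⟩ := h
  obtain ⟨Y₂', Z₂, k⟩ := k
  dsimp only at e e'
  subst e e'
  rcases f with _ | f <;> rcases g with _ | g <;> rcases h with _ | h <;> rcases k with _ | k <;>
    simp [seq, b, D.buh_comp]

lemma o_assoc (f g h : Ar D) : (f ⊚ g) ⊚ h = f ⊚ g ⊚ h := by
  obtain ⟨X, Y, f⟩ := f
  obtain ⟨X', Y', g⟩ := g
  obtain ⟨X'', Y'', h⟩ := h
  rcases f with _ | f <;> rcases g with _ | g <;> rcases h with _ | h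
  case some.some.some =>
    exact of_eq_of _ _ (D.coA _ _ _) (D.coA _ _ _).symm (D.coh_assoc f g h)
  all_goals exact mk_none (D.coA _ _ _) (D.coA _ _ _)

lemma b_assoc (f g h : Ar D) : (f ⊡ g) ⊡ h = f ⊡ g ⊡ h := by
  obtain ⟨X, Y, f⟩ := f
  obtain ⟨X', Y', g⟩ := g
  obtain ⟨X'', Y'', h⟩ := h
  rcases f with _ | f <;> rcases g with _ | g <;> rcases h with _ | h
  case some.some.some =>
    exact of_eq_of _ _ (D.buA _ _ _) (D.buA _ _ _).symm (D.buh_assoc f g h)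
  all_goals exact mk_none (D.buA _ _ _) (D.buA _ _ _)

@[simp] lemma one_o (f : Ar D) : one D D.uI ⊚ f = f := by
  obtain ⟨X, Y, f⟩ := f
  rcases f with _ | f
  · exact mk_none (D.coL _) (D.coL _)
  · exact of_eq_of _ _ (D.coL _) (D.coL _).symm (D.coh_unitL f)

@[simp] lemma o_one (f : Ar D) : f ⊚ one D D.uI = f := by
  obtain ⟨X, Y, f⟩ := f
  rcases f with _ | f
  · exact mk_none (D.coR _) (D.coR _)
  · exact of_eq_of _ _ (D.coR _) (D.coR _).symm (D.coh_unitR f)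

@[simp] lemma one_b (f : Ar D) : one D D.uJ ⊡ f = f := by
  obtain ⟨X, Y, f⟩ := f
  rcases f with _ | f
  · exact mk_none (D.buL _) (D.buL _)
  · exact of_eq_of _ _ (D.buL _) (D.buL _).symm (D.buh_unitL f)

@[simp] lemma b_one (f : Ar D) : f ⊡ one D D.uJ = f := by
  obtain ⟨X, Y, f⟩ := f
  rcases f with _ | f
  · exact mk_none (D.buR _) (D.buR _)
  · exact of_eq_of _ _ (D.buR _) (D.buR _).symm (D.buh_unitR f)

lemma z_nat (f g h k : Ar D) :
    ((f ⊡ g) ⊚ (h ⊡ k)) ⨾ z D f.cod g.cod h.cod k.cod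
      = z D f.dom g.dom h.dom k.dom ⨾ ((f ⊚ h) ⊡ (g ⊚ k)) := by
  obtain ⟨X, Y, f⟩ := f
  obtain ⟨X', Y', g⟩ := g
  obtain ⟨X₂, Y₂, h⟩ := h
  obtain ⟨X₂', Y₂', k⟩ := k
  rcases f with _ | f <;> rcases g with _ | g <;> rcases h with _ | h <;> rcases k with _ | k <;>
    simp [seq, b, o, z, of, D.zt_nat]

lemma z_assoc₁ (A B C E F G : M) :
    (z D A B C E ⊚ one D (D.bu F G)) ⨾ z D (D.co A C) (D.co B E) F G
      = (one D (D.bu A B) ⊚ z D C E F G) ⨾ z D A B (D.co C F) (D.co E G) := by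
  simp only [z, one, ← of_coh, ← of_comp]
  refine of_eq_of _ _ (D.coA _ _ _) (by simp [D.coA]) ?_
  simpa only [Category.assoc] using D.zt_assoc1 A B C E F G

lemma z_assoc₂ (A B C E F G : M) :
    z D (D.bu A B) C (D.bu E F) G ⨾ (z D A B E F ⊡ one D (D.co C G))
      = z D A (D.bu B C) E (D.bu F G) ⨾ (one D (D.co A E) ⊡ z D B C F G) := by
  simp only [z, one, ← of_buh, ← of_comp]
  refine of_eq_of _ _ (by simp [D.buA]) (by simp [D.buA]) ?_
  simpa only [Category.assoc] using D.zt_assoc2 A B C E F G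

lemma z_unit_right (A B : M) :
    (one D (D.bu A B) ⊚ of D D.dlI) ⨾ z D A B D.uI D.uI = one D (D.bu A B) := by
  have h := congrArg (of D) (D.zt_unitB A B)
  simpa only
    [↓of_eqToHom_comp, ↓of_comp_eqToHom, of_comp, of_coh, of_buh, of_id, of_zt] using h

/-- A pair of objects acted on through a morphism with values in `C • E`, followed by the
interchange. -/
noncomputable def act (Y Z C E : M) (s : Ar D) : Ar D :=
  (one D (D.bu Y Z) ⊚ s) ⨾ z D Y Z C E

@[simp] lemma act_dom (Y Z C E : M) (s : Ar D) :
    (act Y Z C E s).dom = D.co (D.bu Y Z) s.dom := (rfl)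
@[simp] lemma act_cod (Y Z C E : M) (s : Ar D) :
    (act Y Z C E s).cod = D.bu (D.co Y C) (D.co Z E) := (rfl)

lemma o_one_seq {f g : Ar D} (X : M) (e : f.cod = g.dom) :
    (f ⨾ g) ⊚ one D X = (f ⊚ one D X) ⨾ (g ⊚ one D X) := by
  rw [← o_seq e rfl, one_seq X (one D X) rfl]

lemma one_o_seq {f g : Ar D} (X : M) (e : f.cod = g.dom) :
    one D X ⊚ (f ⨾ g) = (one D X ⊚ f) ⨾ (one D X ⊚ g) := by
  rw [← o_seq rfl e, one_seq X (one D X) rfl]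

lemma b_one_seq {f g : Ar D} (X : M) (e : f.cod = g.dom) :
    (f ⨾ g) ⊡ one D X = (f ⊡ one D X) ⨾ (g ⊡ one D X) := by
  rw [← b_seq e rfl, one_seq X (one D X) rfl]

lemma one_b_seq {f g : Ar D} (X : M) (e : f.cod = g.dom) :
    one D X ⊡ (f ⨾ g) = (one D X ⊡ f) ⨾ (one D X ⊡ g) := by
  rw [← b_seq rfl e, one_seq X (one D X) rfl]

lemma seq_b_of_dom_left {f g h : Ar D} (e : g.dom = D.uJ) (e' : f.cod = h.dom) :
    f ⨾ (g ⊡ h) = g ⊡ (f ⨾ h) := by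
  conv_lhs => rw [← one_b f]
  rw [← b_seq e.symm e', one_seq _ _ e]

lemma seq_b_of_dom_right {f g h : Ar D} (e : g.dom = D.uJ) (e' : f.cod = h.dom) :
    f ⨾ (h ⊡ g) = (f ⨾ h) ⊡ g := by
  conv_lhs => rw [← b_one f]
  rw [← b_seq e' e.symm, one_seq _ _ e]

lemma o_exch {f g : Ar D} {X Y X' Y' : M} (hf : f.dom = X) (hg : g.dom = X') (hf' : f.cod = Y)
    (hg' : g.cod = Y') :
    (f ⊚ one D X') ⨾ (one D Y ⊚ g) = (one D X ⊚ g) ⨾ (f ⊚ one D Y') := by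
  subst hf hg hf' hg'
  rw [← o_seq rfl rfl, ← o_seq rfl rfl, one_seq _ g rfl, one_seq _ _ rfl, seq_one _ f rfl,
    seq_one _ _ rfl]

lemma act_nat {h k s : Ar D} {Y Z Y' Z' C E B : M} (hs : s.cod = D.bu C E) (hB : s.dom = B)
    (h₁ : h.dom = Y) (h₂ : h.cod = Y') (k₁ : k.dom = Z) (k₂ : k.cod = Z') :
    ((h ⊡ k) ⊚ one D B) ⨾ act Y' Z' C E s
      = act Y Z C E s ⨾ ((h ⊚ one D C) ⊡ (k ⊚ one D E)) := by
  subst h₁ h₂ k₁ k₂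
  have := z_nat h k (one D C) (one D E)
  simp only [one_dom, one_cod] at this
  rw [act, act, ← seq_seq, o_exch (b_dom h k) hB (b_cod h k) hs, seq_seq, seq_seq, one_bu C E, this]

/-- Naturality of `act` for a morphism out of the unit object `I`. -/
lemma act_nat_unit {h k s : Ar D} {Y Z Y' Z' C E : M} (hs : s.cod = D.bu C E) (hB : s.dom = D.uI)
    (h₁ : h.dom = Y) (h₂ : h.cod = Y') (k₁ : k.dom = Z) (k₂ : k.cod = Z') :
    (h ⊡ k) ⨾ act Y' Z' C E s = act Y Z C E s ⨾ ((h ⊚ one D C) ⊡ (k ⊚ one D E)) := by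
  simpa using act_nat hs hB h₁ h₂ k₁ k₂

lemma seq_act {t s : Ar D} (Y Z C E : M) (e : t.cod = s.dom) :
    (one D (D.bu Y Z) ⊚ t) ⨾ act Y Z C E s = act Y Z C E (t ⨾ s) := by
  rw [act, act, one_o_seq _ e, seq_seq]

lemma act_seq {s c d : Ar D} {C E C' E' : M} (Y Z : M) (hs : s.cod = D.bu C E)
    (c₁ : c.dom = C) (c₂ : c.cod = C') (d₁ : d.dom = E) (d₂ : d.cod = E') :
    act Y Z C E s ⨾ ((one D Y ⊚ c) ⊡ (one D Z ⊚ d)) = act Y Z C' E' (s ⨾ (c ⊡ d)) := by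
  subst c₁ c₂ d₁ d₂
  have := z_nat (one D Y) (one D Z) c d
  simp only [one_dom, one_cod] at this
  rw [act, act, one_o_seq _ hs, seq_seq, seq_seq, one_bu Y Z, this]

lemma act_assoc (P B C E F G : M) (s : Ar D) :
    act P (D.bu B C) E (D.bu F G) s ⨾ (one D (D.co P E) ⊡ z D B C F G)
      = act (D.bu P B) C (D.bu E F) G s ⨾ (z D P B E F ⊡ one D (D.co C G)) := by
  rw [act, act, seq_seq, seq_seq, z_assoc₂, D.buA]

lemma one_o_act {s : Ar D} (P Q B C E F : M) (h : s.dom = D.uI) (h' : s.cod = D.bu E F) :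
    (one D (D.bu P Q) ⊚ act B C E F s) ⨾ z D P Q (D.co B E) (D.co C F)
      = z D P Q B C ⨾ act (D.co P B) (D.co Q C) E F s := by
  have hx := o_exch (f := z D P Q B C) (g := s) (z_dom P Q B C) h (z_cod P Q B C) h'
  rw [o_one, one_co, o_assoc] at hx
  rw [act, act, one_o_seq _ (by simp [h']), seq_seq, ← z_assoc₁, ← seq_seq, ← seq_seq]
  exact congrArg (· ⨾ _) hx.symm

lemma act_dlI (B C : M) : act B C D.uI D.uI (of D D.dlI) = one D (D.bu B C) :=
  z_unit_right B C

lemma dlI_counit_right : of D D.dlI ⨾ (one D D.uI ⊡ of D D.tau) = one D D.uI := by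
  have h := congrArg (of D) D.dlI_counitR
  simpa only
    [↓of_eqToHom_comp, ↓of_comp_eqToHom, of_comp, of_coh, of_buh, of_id, of_zt] using h

lemma dlI_tail {s : Ar D} {Y : M} (h : s.dom = D.uI) (h' : s.cod = Y) :
    of D D.dlI ⨾ (s ⊡ one D D.uI) ⨾ (one D Y ⊡ of D D.tau) = s := by
  subst h'
  have e : (s ⊡ one D D.uI) ⨾ (one D s.cod ⊡ of D D.tau) = (one D D.uI ⊡ of D D.tau) ⨾ s := by
    conv_rhs => rw [← b_one s]
    rw [← b_seq rfl rfl, ← b_seq h.symm rfl, one_seq D.uI (of D D.tau) rfl, one_seq _ _ h,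
      seq_one _ s rfl, seq_one D.uJ _ rfl]
  rw [e, ← seq_seq, dlI_counit_right, one_seq _ _ h]

end Ar

namespace RWB

open Ar

variable {M : Type u} [Category.{v} M] {D : Duo M} (W : RWB D)

/-- The bundled morphism `Δ.η`. -/
def uu : Ar D := of D (W.eta ≫ W.dl)

/-- The right action `J∘μ` of `A` on `J∘A`. -/
def mm : Ar D := one D D.uJ ⊚ of D W.mu

/-- The morphism `ϖ.(J∘ε)`. -/
noncomputable def ee₀ : Ar D := (one D D.uJ ⊚ of D W.ep) ⨾ of D D.pw

/-- The morphism `ϖ.(J∘(ε.μ))`. -/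
noncomputable def ee : Ar D := W.mm ⨾ W.ee₀

/-- The morphism `((J∘A)•(ϖ.(J∘(ε.μ)))).ζ.(J∘A∘Δ)`. -/
noncomputable def ff : Ar D := act D.uJ W.JA W.A W.A (of D W.dl) ⨾ (one D W.JA ⊡ W.ee)

/-- The morphism `((ϖ.(J∘(ε.μ)))•(J∘A)).ζ.(J∘A∘Δ)`. -/
noncomputable def ffb : Ar D := act W.JA D.uJ W.A W.A (of D W.dl) ⨾ (W.ee ⊡ one D W.JA)

@[simp] lemma uu_dom : W.uu.dom = D.uI := (rfl)
@[simp] lemma uu_cod : W.uu.cod = D.bu W.A W.A := (rfl)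
@[simp] lemma mm_dom : W.mm.dom = D.co W.JA W.A := (D.coA _ _ _).symm
@[simp] lemma mm_cod : W.mm.cod = W.JA := (rfl)
@[simp] lemma ee₀_dom : W.ee₀.dom = W.JA := (rfl)
@[simp] lemma ee₀_cod : W.ee₀.cod = D.uJ := (rfl)
@[simp] lemma ee_dom : W.ee.dom = D.co W.JA W.A := W.mm_dom
@[simp] lemma ee_cod : W.ee.cod = D.uJ := (rfl)
@[simp] lemma ff_dom : W.ff.dom = D.co W.JA W.A := by simp [ff, D.buL]
@[simp] lemma ff_cod : W.ff.cod = W.JA := by simp [ff, D.buR]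
@[simp] lemma ffb_dom : W.ffb.dom = D.co W.JA W.A := by simp [ffb, D.buR]
@[simp] lemma ffb_cod : W.ffb.cod = W.JA := by simp [ffb, D.buL]

lemma one_JA : one D W.JA = one D D.uJ ⊚ one D W.A := one_co _ _

lemma uu_eq : W.uu = of D W.eta ⨾ of D W.dl := of_comp _ _

lemma mm_assoc : (W.mm ⊚ one D W.A) ⨾ W.mm = (one D W.JA ⊚ of D W.mu) ⨾ W.mm := by
  have h := congrArg (of D) W.mu_assoc
  simp only [↓of_eqToHom_comp, of_comp, of_coh, of_id] at h
  rw [mm, one_JA, o_assoc, o_assoc, ← one_o_seq _ rfl, ← one_o_seq _ rfl, h]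

lemma mm_unit : (one D W.JA ⊚ of D W.eta) ⨾ W.mm = one D W.JA := by
  have h := congrArg (of D) W.mu_unitR
  simp only [↓of_eqToHom_comp, of_comp, of_coh, of_id] at h
  rw [mm, one_JA, o_assoc, ← one_o_seq _ (by simp), h]

lemma dl_coassoc_ar : of D W.dl ⨾ (of D W.dl ⊡ one D W.A)
    = of D W.dl ⨾ (one D W.A ⊡ of D W.dl) := by
  have h := congrArg (of D) W.dl_coassoc
  simpa only [↓of_comp_eqToHom, of_comp, of_buh, of_id] using h

lemma uu_coassoc : W.uu ⨾ (of D W.dl ⊡ one D W.A) = W.uu ⨾ (one D W.A ⊡ of D W.dl) := by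
  rw [uu_eq, seq_seq, seq_seq, dl_coassoc_ar]

lemma ee_eq : (one D D.uJ ⊚ (of D W.mu ⨾ of D W.ep)) ⨾ of D D.pw = W.ee := by
  rw [ee, ee₀, mm, one_o_seq _ rfl, seq_seq]

lemma act_uJ_left (Z C E : M) (s : Ar D) :
    act D.uJ Z C E s = (one D Z ⊚ s) ⨾ z D D.uJ Z C E := by
  rw [act, one_bu, one_b]

lemma act_uJ_right (Y C E : M) (s : Ar D) :
    act Y D.uJ C E s = (one D Y ⊚ s) ⨾ z D Y D.uJ C E := by
  rw [act, one_bu, b_one]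

lemma ff_ee : (W.ff ⊚ one D W.A) ⨾ W.ee = (one D W.JA ⊚ of D W.mu) ⨾ W.ee := by
  have h : of D _ = of D _ := congrArg (of D) W.llc
  simp only [↓of_eqToHom_comp, of_comp, of_coh, of_buh, of_id, of_zt] at h
  rw [ee_eq, show one D (D.co D.uJ W.A) = one D W.JA from rfl] at h
  rw [ff, act_uJ_left, ← ee_eq, one_b_seq _ rfl, seq_seq, o_one_seq _ (by simp [D.buL]),
    o_one_seq _ (by simp [JA, D.coA]), o_one_seq _ (by simp), seq_seq, seq_seq, seq_seq, ee_eq]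
  refine h.trans ?_
  rw [ee, mm, ee₀]

lemma ffb_ee : (W.ffb ⊚ one D W.A) ⨾ W.ee = (one D W.JA ⊚ of D W.mu) ⨾ W.ee := by
  have h : of D _ = of D _ := congrArg (of D) W.lrc
  simp only [↓of_eqToHom_comp, of_comp, of_coh, of_buh, of_id, of_zt] at h
  rw [ee_eq, show one D (D.co D.uJ W.A) = one D W.JA from rfl] at h
  rw [ffb, act_uJ_right, ← ee_eq, b_one_seq _ rfl, seq_seq, o_one_seq _ (by simp [D.buR]),
    o_one_seq _ (by simp [JA, D.coA]), o_one_seq _ (by simp), seq_seq, seq_seq, seq_seq, ee_eq]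
  refine h.trans ?_
  rw [ee, mm, ee₀]

lemma lru_ar : of D D.dlI ⨾ (W.uu ⊡ one D D.uI) ⨾
    (one D W.A ⊡ (act W.A D.uI W.A W.A W.uu ⨾ (of D W.mu ⊡ one D W.A)))
      = W.uu ⨾ (one D W.A ⊡ of D W.dl) := by
  have h : of D _ = of D _ := congrArg (of D) W.lru
  simp only [↓of_eqToHom_comp, of_comp, of_coh, of_buh, of_id, of_zt] at h
  rw [b_one_seq _ (by rfl)] at h
  have hl : of D D.dlI ⨾ (W.uu ⊡ one D D.uI) ⨾ (one D W.A ⊡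
      (act W.A D.uI W.A (D.bu W.A D.uI) (of D D.dlI ⨾ W.uu ⊡ one D D.uI) ⨾
        (of D W.mu ⊡ (one D W.A ⊡ one D D.uI))))
      = of D D.dlI ⨾ ((W.uu ⨾ (of D W.dl ⊡ one D W.A)) ⊡ one D D.uI) := by
    rw [act, one_o_seq _ rfl, seq_seq, seq_seq, one_b_seq _ (by simp),
      one_b_seq _ (by simp [D.buA]), one_b_seq _ (by simp [D.coL]), b_one_seq _ (by simp),
      uu_eq, b_one_seq _ (by simp)]
    simpa only [seq_seq, b_assoc] using h
  have ht := congrArg (· ⨾ (one D (D.bu (D.bu W.A W.A) W.A) ⊡ of D D.tau)) hl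
  simp only [seq_seq] at ht
  rw [dlI_tail (s := W.uu ⨾ _) (Y := D.bu (D.bu W.A W.A) W.A) rfl rfl, uu_coassoc] at ht
  have e : (of D W.mu ⊡ one D W.A ⊡ one D D.uI) ⨾ (one D W.A ⊡ one D W.A ⊡ of D D.tau)
      = ((one D W.A ⊚ one D W.A) ⊡ (one D D.uI ⊚ (one D W.A ⊡ of D D.tau))) ⨾
        (of D W.mu ⊡ one D W.A) := by
    rw [← one_co, one_o, ← b_seq (by simp) (by simp), ← b_seq (by simp) (by simp),
      ← b_seq (by simp) (by simp [D.buR])]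
    simp [one_seq, seq_one, D.buR]
  rw [← ht, one_bu, one_bu, b_assoc, b_assoc,
    ← one_b_seq (g := one D W.A ⊡ one D W.A ⊡ of D D.tau) _ (by simp), seq_seq, e,
    ← seq_seq (act _ _ _ _ _), act_seq (C' := W.A) (E' := W.A) _ _ (by simp [D.buA])
      (by simp) (by simp) (by simp) (by simp [D.buR]), seq_seq, ← b_assoc, ← one_bu,
      dlI_tail (by simp) (by simp)]

lemma sqcapR_ar : of D W.sqcapR = act D.uJ W.JA W.A W.A W.uu ⨾ (one D W.JA ⊡ W.ee) := by
  have h : of D W.sqcapR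
      = of D (eqToHom (show D.co D.uJ W.A = D.co (D.co D.uJ W.A) D.uI by simp [D.coR])
    ≫ D.coh (𝟙 (D.co D.uJ W.A)) (W.eta ≫ W.dl)
    ≫ eqToHom (show D.co (D.co D.uJ W.A) (D.bu W.A W.A)
        = D.co (D.bu D.uJ (D.co D.uJ W.A)) (D.bu W.A W.A) by simp [D.buL])
    ≫ D.zt D.uJ (D.co D.uJ W.A) W.A W.A
    ≫ D.buh (𝟙 (D.co D.uJ W.A)) (eqToHom (D.coA D.uJ W.A W.A) ≫ D.coh (𝟙 D.uJ) (W.mu ≫ W.ep))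
    ≫ D.buh (𝟙 (D.co D.uJ W.A)) D.pw
    ≫ eqToHom (D.buR (D.co D.uJ W.A))) := (rfl)
  simp only [↓of_eqToHom_comp, ↓of_comp_eqToHom, of_comp, of_coh, of_buh, of_id, of_zt] at h
  rw [h, act_uJ_left, ← ee_eq, one_b_seq _ rfl, seq_seq, uu_eq]
  rfl

lemma sqcapLbar_ar : of D W.sqcapLbar = act W.JA D.uJ W.A W.A W.uu ⨾ (W.ee ⊡ one D W.JA) := by
  have h : of D W.sqcapLbar
      = of D (eqToHom (show D.co D.uJ W.A = D.co (D.co D.uJ W.A) D.uI by simp [D.coR])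
    ≫ D.coh (𝟙 (D.co D.uJ W.A)) (W.eta ≫ W.dl)
    ≫ eqToHom (show D.co (D.co D.uJ W.A) (D.bu W.A W.A)
        = D.co (D.bu (D.co D.uJ W.A) D.uJ) (D.bu W.A W.A) by simp [D.buR])
    ≫ D.zt (D.co D.uJ W.A) D.uJ W.A W.A
    ≫ D.buh (eqToHom (D.coA D.uJ W.A W.A) ≫ D.coh (𝟙 D.uJ) (W.mu ≫ W.ep) ≫ D.pw)
        (𝟙 (D.co D.uJ W.A))
    ≫ eqToHom (D.buL (D.co D.uJ W.A))) := rfl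
  simp only [↓of_eqToHom_comp, ↓of_comp_eqToHom, of_comp, of_coh, of_buh, of_id, of_zt] at h
  rw [h, act_uJ_right, ← ee_eq, seq_seq, uu_eq]
  rfl

lemma mm_ee : (W.mm ⊚ one D W.A) ⨾ W.ee = (one D W.JA ⊚ of D W.mu) ⨾ W.ee := by
  rw [ee, ← seq_seq, mm_assoc, seq_seq]

lemma mu_unit_left : (of D W.eta ⊚ one D W.A) ⨾ of D W.mu = one D W.A := by
  have h := congrArg (of D) W.mu_unitL
  simpa only [↓of_eqToHom_comp, of_comp, of_coh, of_id] using h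

lemma eta_ff : (one D W.JA ⊚ of D W.eta) ⨾ W.ff = of D W.sqcapR := by
  have h := seq_act (t := of D W.eta) (s := of D W.dl) D.uJ W.JA W.A W.A (by simp)
  rw [one_bu, one_b] at h
  rw [ff, ← seq_seq, h, sqcapR_ar, uu_eq]

lemma eta_ffb : (one D W.JA ⊚ of D W.eta) ⨾ W.ffb = of D W.sqcapLbar := by
  have h := seq_act (t := of D W.eta) (s := of D W.dl) W.JA D.uJ W.A W.A (by simp)
  rw [one_bu, b_one] at h
  rw [ffb, ← seq_seq, h, sqcapLbar_ar, uu_eq]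

lemma eta_ee {t : Ar D} (ht : t.dom = D.co W.JA W.A)
    (h : (t ⊚ one D W.A) ⨾ W.ee = (one D W.JA ⊚ of D W.mu) ⨾ W.ee) :
    (((one D W.JA ⊚ of D W.eta) ⨾ t) ⊚ one D W.A) ⨾ W.ee = W.ee := by
  rw [o_one_seq _ (by simp [ht]), seq_seq, h, o_assoc, ← seq_seq, ← one_o_seq _ (by simp),
    mu_unit_left, ← one_co, one_seq _ _ (by simp)]

lemma sqcapR_ee : (of D W.sqcapR ⊚ one D W.A) ⨾ W.ee = W.ee := by
  rw [← eta_ff]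
  exact W.eta_ee (by simp) W.ff_ee

lemma sqcapLbar_ee : (of D W.sqcapLbar ⊚ one D W.A) ⨾ W.ee = W.ee := by
  rw [← eta_ffb]
  exact W.eta_ee (by simp) W.ffb_ee

lemma ee₀_of_ee {s : Ar D} (hs : s.dom = W.JA) (hs' : s.cod = W.JA)
    (h : (s ⊚ one D W.A) ⨾ W.ee = W.ee) : s ⨾ W.ee₀ = W.ee₀ := by
  have e : (one D W.JA ⊚ of D W.eta) ⨾ W.ee = W.ee₀ := by
    rw [ee, ← seq_seq, mm_unit, one_seq _ _ (by simp)]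
  have hx := o_exch (f := s) (g := of D W.eta) hs (of_dom _) hs' (of_cod _)
  rw [o_one] at hx
  rw [← e, ← seq_seq, hx, seq_seq, h]

lemma comp_sqcapR {h : Ar D} {Y : M} (hd : h.dom = Y) (hc : h.cod = W.JA) :
    h ⨾ of D W.sqcapR
      = act D.uJ Y W.A W.A W.uu ⨾ (one D W.JA ⊡ ((h ⊚ one D W.A) ⨾ W.ee)) := by
  have hx := act_nat_unit (h := one D D.uJ) (k := h) W.uu_cod W.uu_dom (one_dom _) (one_cod _) hd hc
  rw [one_b, ← one_co] at hx
  rw [sqcapR_ar, ← seq_seq, hx, seq_seq, ← b_seq (by simp; rfl) (by simp [hc])]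
  rw [show D.co D.uJ W.A = W.JA from rfl, seq_one _ _ (by simp)]

lemma comp_sqcapLbar {h : Ar D} {Y : M} (hd : h.dom = Y) (hc : h.cod = W.JA) :
    h ⨾ of D W.sqcapLbar
      = act Y D.uJ W.A W.A W.uu ⨾ (((h ⊚ one D W.A) ⨾ W.ee) ⊡ one D W.JA) := by
  have hx := act_nat_unit (k := one D D.uJ) (h := h) W.uu_cod W.uu_dom hd hc (one_dom _) (one_cod _)
  rw [b_one, ← one_co] at hx
  rw [sqcapLbar_ar, ← seq_seq, hx, seq_seq, ← b_seq (by simp [hc]) (by simp; rfl)]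
  rw [show D.co D.uJ W.A = W.JA from rfl, seq_one _ _ (by simp)]

/-- Two morphisms into `J∘A` which agree after acting and applying the counit. -/
structure EEq (h k : Ar D) : Prop where
  dom : h.dom = k.dom
  cod : h.cod = W.JA
  cod' : k.cod = W.JA
  ee : (h ⊚ one D W.A) ⨾ W.ee = (k ⊚ one D W.A) ⨾ W.ee

variable {W}

lemma EEq.sqcapR {h k : Ar D} (e : W.EEq h k) : h ⨾ of D W.sqcapR = k ⨾ of D W.sqcapR := by
  rw [W.comp_sqcapR e.dom e.cod, W.comp_sqcapR rfl e.cod', e.ee]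

lemma EEq.sqcapLbar {h k : Ar D} (e : W.EEq h k) :
    h ⨾ of D W.sqcapLbar = k ⨾ of D W.sqcapLbar := by
  rw [W.comp_sqcapLbar e.dom e.cod, W.comp_sqcapLbar rfl e.cod', e.ee]

variable (W)

lemma eeq_ff : W.EEq W.ff W.mm := ⟨by simp, by simp, by simp, by rw [ff_ee, mm_ee]⟩

lemma eeq_ffb : W.EEq W.ffb W.mm := ⟨by simp, by simp, by simp, by rw [ffb_ee, mm_ee]⟩

lemma eeq_sqcapR : W.EEq (of D W.sqcapR) (one D W.JA) :=
  ⟨by simp, by simp, by simp, by rw [sqcapR_ee, ← one_co, one_seq _ _ (by simp)]⟩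

lemma eeq_sqcapLbar : W.EEq (of D W.sqcapLbar) (one D W.JA) :=
  ⟨by simp, by simp, by simp, by rw [sqcapLbar_ee, ← one_co, one_seq _ _ (by simp)]⟩

variable {W}

lemma EEq.act {s : Ar D} (e : W.EEq s (one D W.JA)) :
    W.EEq ((s ⊚ one D W.A) ⨾ W.mm) W.mm := by
  have h : (s ⊚ one D W.A) ⨾ W.ee = W.ee := by
    rw [e.ee, ← one_co, one_seq _ _ (by simp)]
  have hd : s.dom = W.JA := e.dom
  have hx := o_exch (f := s) (g := of D W.mu) hd (of_dom _) e.cod (of_cod _)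
  rw [one_co] at hx
  refine ⟨by simp [hd], by simp, by simp, ?_⟩
  rw [o_one_seq _ (by simp [e.cod]), seq_seq, mm_ee, o_assoc, ← seq_seq, hx, seq_seq, h]

variable (W)

/-- A morphism out of `J∘A` that identifies any two morphisms into `J∘A` which agree after
acting and applying the counit. -/
structure Absorbs (c : Ar D) : Prop where
  dom : c.dom = W.JA
  eq : ∀ {h k : Ar D}, W.EEq h k → h ⨾ c = k ⨾ c

lemma absorbs_of_retract {R : M} {p : W.JA ⟶ R} {i : R ⟶ W.JA} (hip : i ≫ p = 𝟙 R)
    (H : ∀ {h k : Ar D}, W.EEq h k → h ⨾ of D (p ≫ i) = k ⨾ of D (p ≫ i)) :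
    W.Absorbs (of D p) := by
  refine ⟨of_dom _, fun {h k} e => ?_⟩
  have hp : of D p = of D (p ≫ i) ⨾ of D p := by
    rw [← of_comp, Category.assoc, hip, Category.comp_id]
  rw [hp, ← seq_seq, H e, seq_seq]

lemma absorbs_ee₀ : W.Absorbs W.ee₀ := by
  refine ⟨by simp, fun {h k} e => ?_⟩
  have he : (one D W.JA ⊚ of D W.eta) ⨾ W.ee = W.ee₀ := by
    rw [ee, ← seq_seq, mm_unit, one_seq _ _ (by simp)]
  have hx := o_exch (f := h) (g := of D W.eta) rfl (of_dom _) e.cod (of_cod _)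
  have kx := o_exch (f := k) (g := of D W.eta) rfl (of_dom _) e.cod' (of_cod _)
  rw [o_one] at hx kx
  rw [← he, ← seq_seq, ← seq_seq, hx, kx, seq_seq, seq_seq, e.ee, e.dom]

/-- The morphism `((c.(J∘μ))•(d.(J∘μ))).ζ.((J∘A)•(J∘A)∘(Δ.η))`. -/
noncomputable def act₂ (c d : Ar D) : Ar D :=
  act W.JA W.JA W.A W.A W.uu ⨾ ((W.mm ⨾ c) ⊡ (W.mm ⨾ d))

variable {W}

lemma act₂_seq {c d c' d' : Ar D} (h : c.cod = c'.dom) (h' : d.cod = d'.dom) :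
    W.act₂ c d ⨾ (c' ⊡ d') = W.act₂ (c ⨾ c') (d ⨾ d') := by
  rw [act₂, act₂, seq_seq, ← b_seq (by simp [h]) (by simp [h']), seq_seq, seq_seq]

lemma seq_act₂ {s t c d : Ar D} {Y Z : M} (hs : s.dom = Y) (hs' : s.cod = W.JA) (ht : t.dom = Z)
    (ht' : t.cod = W.JA) :
    (s ⊡ t) ⨾ W.act₂ c d = act Y Z W.A W.A W.uu ⨾
      (((s ⊚ one D W.A) ⨾ W.mm ⨾ c) ⊡ ((t ⊚ one D W.A) ⨾ W.mm ⨾ d)) := by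
  rw [act₂, ← seq_seq, act_nat_unit W.uu_cod W.uu_dom hs hs' ht ht', seq_seq,
    ← b_seq (by simp [hs']) (by simp [ht'])]

lemma Absorbs.act_eq {c s : Ar D} (hc : W.Absorbs c) (hs : W.EEq s (one D W.JA)) :
    (s ⊚ one D W.A) ⨾ W.mm ⨾ c = W.mm ⨾ c := by
  rw [← seq_seq, hc.eq hs.act]

lemma Absorbs.seq_act₂ {c d s t : Ar D} (hc : W.Absorbs c) (hd : W.Absorbs d)
    (hs : W.EEq s (one D W.JA)) (ht : W.EEq t (one D W.JA)) :
    (s ⊡ t) ⨾ W.act₂ c d = W.act₂ c d := by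
  rw [RWB.seq_act₂ hs.dom hs.cod ht.dom ht.cod, hc.act_eq hs, hd.act_eq ht]
  rfl

lemma eeq_one : W.EEq (one D W.JA) (one D W.JA) := ⟨rfl, one_cod _, one_cod _, rfl⟩

lemma act_uu_right {P Q : M} {c k : Ar D} (hc : c.dom = D.co P W.A)
    (hk : k.dom = D.co Q (D.bu W.A W.A)) :
    act P Q W.A W.A W.uu ⨾ (c ⊡ ((one D Q ⊚ of D W.dl) ⨾ k))
      = act P Q W.A (D.bu W.A W.A) (W.uu ⨾ (one D W.A ⊡ of D W.dl)) ⨾ (c ⊡ k) := by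
  rw [← act_seq _ _ W.uu_cod (one_dom _) (one_cod _) (of_dom _) (of_cod _), seq_seq,
    ← b_seq (by simp [hc]) (by simp [hk]), ← one_co, one_seq _ _ hc]

lemma act_uu_left {P Q : M} {c k : Ar D} (hc : c.dom = D.co Q W.A)
    (hk : k.dom = D.co P (D.bu W.A W.A)) :
    act P Q W.A W.A W.uu ⨾ (((one D P ⊚ of D W.dl) ⨾ k) ⊡ c)
      = act P Q (D.bu W.A W.A) W.A (W.uu ⨾ (of D W.dl ⊡ one D W.A)) ⨾ (k ⊡ c) := by
  rw [← act_seq _ _ W.uu_cod (of_dom _) (of_cod _) (one_dom _) (one_cod _), seq_seq,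
    ← b_seq (by simp [hk]) (by simp [hc]), ← one_co, one_seq _ _ hc]

lemma ff_seq {c : Ar D} (hc : c.dom = W.JA) :
    W.ff ⨾ c = (one D W.JA ⊚ of D W.dl) ⨾ z D D.uJ W.JA W.A W.A ⨾ (c ⊡ W.ee) := by
  have h : (one D W.JA ⊡ W.ee) ⨾ c = c ⊡ W.ee := by
    conv_lhs => rw [← b_one c]
    rw [← b_seq (by simp [hc]) (by simp), one_seq _ _ hc, seq_one _ _ W.ee_cod]
  rw [ff, act_uJ_left, seq_seq, seq_seq, h]

lemma ffb_seq {c : Ar D} (hc : c.dom = W.JA) :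
    W.ffb ⨾ c = (one D W.JA ⊚ of D W.dl) ⨾ z D W.JA D.uJ W.A W.A ⨾ (W.ee ⊡ c) := by
  have h : (W.ee ⊡ one D W.JA) ⨾ c = W.ee ⊡ c := by
    conv_lhs => rw [← one_b c]
    rw [← b_seq (by simp) (by simp [hc]), one_seq _ _ hc, seq_one _ _ W.ee_cod]
  rw [ffb, act_uJ_right, seq_seq, seq_seq, h]

lemma act_lru_tail {c : Ar D} (hc : c.dom = W.JA) :
    (one D W.JA ⊚ (act W.A D.uI W.A W.A W.uu ⨾ (of D W.mu ⊡ one D W.A))) ⨾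
        z D D.uJ W.JA W.A W.A ⨾ (c ⊡ W.ee)
      = z D D.uJ W.JA W.A D.uI ⨾ W.act₂ c W.ee₀ := by
  have hz := z_nat (one D D.uJ) (one D W.JA) (of D W.mu) (one D W.A)
  simp only [one_dom, one_cod, of_dom, of_cod, one_b] at hz
  have ho := one_o_act (D := D) D.uJ W.JA W.A D.uI W.A W.A (s := W.uu) W.uu_dom W.uu_cod
  rw [one_bu, one_b, D.coL, D.coR] at ho
  rw [one_o_seq _ (by simp [D.coL]), seq_seq, ← seq_seq (_ ⊚ (_ ⊡ _)), hz, seq_seq, ← seq_seq,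
    ho, seq_seq, ← b_seq (by simp [hc]; rfl) (by simp), ← one_co, one_seq _ _ W.ee_dom]
  rfl

lemma act_dlI_uu {c : Ar D} (hc : c.dom = D.bu W.JA W.JA) :
    act W.JA W.JA W.A (D.bu W.A D.uI) (of D D.dlI ⨾ (W.uu ⊡ one D D.uI)) ⨾
        (W.ee ⊡ (z D D.uJ W.JA W.A D.uI ⨾ c))
      = (of D W.sqcapLbar ⊡ one D W.JA) ⨾ c := by
  have ha := act_assoc (D := D) W.JA D.uJ W.JA W.A W.A D.uI
    (of D D.dlI ⨾ (W.uu ⊡ one D D.uI))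
  rw [D.buL, D.buR, ← act_seq (C := D.uI) (E := D.uI) _ _ (of_cod _) W.uu_dom W.uu_cod
    (one_dom _) (one_cod _), act_dlI, o_one, one_seq _ _ (by simp [D.coR]), D.coR,
    ← b_one_seq _ (by simp [D.buR])] at ha
  have hb : W.ee ⊡ (z D D.uJ W.JA W.A D.uI ⨾ c)
      = (one D (D.co W.JA W.A) ⊡ z D D.uJ W.JA W.A D.uI) ⨾
        ((W.ee ⊡ one D W.JA) ⊡ one D W.JA) ⨾ c := by
    conv_rhs => rw [← one_b c]
    rw [b_assoc, ← one_bu, ← b_seq (by simp) (by simp [hc]), seq_one _ _ W.ee_cod,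
      one_seq _ _ hc, ← b_seq (by simp) (by simp [hc, D.coR]; rfl), one_seq _ _ W.ee_dom]
  rw [hb, ← seq_seq, ha, ← seq_seq, ← b_one_seq _ (by simp; rfl), sqcapLbar_ar, act_uJ_right]

lemma act₂_counit_comm {c : Ar D} (hc : W.Absorbs c) :
    W.act₂ c W.ee₀ = W.act₂ W.ee₀ c := by
  have hr : W.act₂ W.ee₀ c
      = act W.JA W.JA W.A W.A W.uu ⨾ (W.ee ⊡ ((one D W.JA ⊚ of D W.dl) ⨾
        z D D.uJ W.JA W.A W.A ⨾ (c ⊡ W.ee))) := by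
    rw [← ff_seq hc.dom, hc.eq W.eeq_ff]
    rfl
  rw [hr, act_uu_right W.ee_dom (by simp [D.buL]), ← lru_ar, ← seq_seq (of D D.dlI),
    ← act_seq (C := W.A) (E := D.bu W.A D.uI) _ _ (by simp [D.buA]) (one_dom _) (one_cod _)
      (by simp [D.coR]) (by simp),
    seq_seq, ← one_co, ← b_seq (by simp) (by simp [D.buL]), one_seq _ _ W.ee_dom,
    act_lru_tail hc.dom, act_dlI_uu (by simp [act₂, D.coR]),
    hc.seq_act₂ W.absorbs_ee₀ W.eeq_sqcapLbar eeq_one]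

/-- The bundled form of `J∘η`. -/
def jj (W : RWB D) : Ar D := one D D.uJ ⊚ of D W.eta

@[simp] lemma jj_dom : W.jj.dom = D.uJ := D.coR _
@[simp] lemma jj_cod : W.jj.cod = W.JA := (rfl)

lemma jj_act : (W.jj ⊚ one D W.A) ⨾ W.mm = one D W.JA := by
  rw [jj, mm, o_assoc, ← one_o_seq _ (by simp), mu_unit_left, one_JA]

lemma act₂_unit_comm {c d : Ar D} (hc : W.Absorbs c) (hd : W.Absorbs d) :
    (W.jj ⊡ one D W.JA) ⨾ W.act₂ c d = (one D W.JA ⊡ W.jj) ⨾ W.act₂ c d := by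
  have hl : W.mm ⨾ d = W.ffb ⨾ d := (hd.eq W.eeq_ffb).symm
  have hr : W.mm ⨾ c = W.ff ⨾ c := (hc.eq W.eeq_ff).symm
  have ha := act_assoc D.uJ W.JA D.uJ W.A W.A W.A (W.uu ⨾ (one D W.A ⊡ of D W.dl))
  have h₁ : act D.uJ W.JA W.A W.A W.uu ⨾ (c ⊡ (W.mm ⨾ d))
      = (act D.uJ W.JA W.A (D.bu W.A W.A) (W.uu ⨾ (one D W.A ⊡ of D W.dl)) ⨾
        (one D W.JA ⊡ z D W.JA D.uJ W.A W.A)) ⨾ (c ⊡ W.ee ⊡ d) := by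
    rw [hl, ffb_seq hd.dom, act_uu_right hc.dom (by simp [D.buR]), seq_seq,
      ← b_seq (by simp [hc.dom]) (by simp [hd.dom]; rfl), one_seq _ _ hc.dom]
  have h₂ : act W.JA D.uJ W.A W.A W.uu ⨾ ((W.mm ⨾ c) ⊡ d)
      = (act W.JA D.uJ (D.bu W.A W.A) W.A (W.uu ⨾ (of D W.dl ⊡ one D W.A)) ⨾
        (z D D.uJ W.JA W.A W.A ⊡ one D W.JA)) ⨾ (c ⊡ W.ee ⊡ d) := by
    rw [hr, ff_seq hc.dom, act_uu_left hd.dom (by simp [D.buL]), seq_seq, ← b_assoc,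
      ← b_seq (by simp [hc.dom]; rfl) (by simp [hd.dom]), one_seq _ _ hd.dom]
  rw [RWB.seq_act₂ W.jj_dom W.jj_cod (one_dom _) (one_cod _),
    RWB.seq_act₂ (one_dom _) (one_cod _) W.jj_dom W.jj_cod, ← seq_seq (W.jj ⊚ _),
    ← seq_seq (W.jj ⊚ _), jj_act,
    ← one_co, one_seq _ c hc.dom, one_seq _ d hd.dom, one_seq _ (W.mm ⨾ d) (by simp),
    one_seq _ (W.mm ⨾ c) (by simp), h₁, h₂, uu_coassoc]
  rw [D.buL, D.buR] at ha
  exact congrArg (· ⨾ _) ha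

variable (W)

lemma chiR_ar (F G : M) (f : D.co F W.A ⟶ F) (g : D.co G W.A ⟶ G) :
    of D (W.chiR F G f g) = act F G W.A W.A W.uu ⨾ (of D f ⊡ of D g) := by
  rw [chiR, of_eqToHom_comp, act, uu_eq, seq_seq]
  simp only [of_comp, of_coh, of_buh, of_id, of_zt]

lemma gamA_ar (R : M) (p : W.JA ⟶ R) (i : R ⟶ W.JA) :
    of D (W.gamA R p i) = (of D i ⊚ one D W.A) ⨾ W.mm ⨾ of D p :=
  (of_comp _ _).trans (congrArg (_ ⨾ ·) ((of_eqToHom_comp _ _).trans (of_comp _ _)))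

/-- The morphism `ϖ.(J∘ε)`. -/
def counit : W.JA ⟶ D.uJ := D.coh (𝟙 D.uJ) W.ep ≫ D.pw

lemma counit_ar : of D W.counit = W.ee₀ := of_comp _ _

lemma jeta_ar : of D W.jeta = W.jj := of_eqToHom_comp _ _

/-- The idempotent `χ^R_{R,R}` for the action of `A` on a retract `R` of `J∘A`. -/
lemma chiR_gamA_ar (R : M) (p : W.JA ⟶ R) (i : R ⟶ W.JA) :
    of D (W.chiR R R (W.gamA R p i) (W.gamA R p i))
      = (of D i ⊡ of D i) ⨾ W.act₂ (of D p) (of D p) := by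
  rw [chiR_ar, gamA_ar, RWB.seq_act₂ (of_dom _) (of_cod _) (of_dom _) (of_cod _)]

lemma muR_ar {R : M} {p : W.JA ⟶ R} {i : R ⟶ W.JA} (hpi : of D p ⨾ of D i ⨾ W.ee₀ = W.ee₀) :
    of D (W.muR R p i) = (of D i ⊡ of D i) ⨾ W.act₂ (of D p) W.ee₀ := by
  have h : of D (W.muR R p i) = of D (W.chiR R R (W.gamA R p i) (W.gamA R p i)) ⨾
      (one D R ⊡ of D i) ⨾ (one D R ⊡ (one D D.uJ ⊚ of D W.ep)) ⨾ (one D R ⊡ of D D.pw) :=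
    (of_comp _ _).trans (congrArg (_ ⨾ ·) ((of_comp _ _).trans (congrArg (_ ⨾ ·)
      ((of_comp _ _).trans (congrArg (_ ⨾ ·) (of_comp_eqToHom _ _))))))
  rw [h, ← one_b_seq (f := _ ⊚ _) _ rfl, ← one_b_seq _ rfl, chiR_gamA_ar, seq_seq,
    act₂_seq rfl rfl, seq_one _ _ (of_cod _)]
  exact congrArg (fun t => _ ⨾ W.act₂ _ t) hpi

/-- The counit-first multiplication on a retract of `J∘A`. -/
lemma mu_ar {R : M} {p : W.JA ⟶ R} {i : R ⟶ W.JA} (hpi : of D p ⨾ of D i ⨾ W.ee₀ = W.ee₀) :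
    of D (W.chiR R R (W.gamA R p i) (W.gamA R p i) ≫ D.buh i (𝟙 R) ≫
      D.buh W.counit (𝟙 R) ≫ eqToHom (D.buL R))
      = (of D i ⊡ of D i) ⨾ W.act₂ W.ee₀ (of D p) := by
  simp only [↓of_comp_eqToHom, of_comp, of_buh, of_id]
  rw [← b_one_seq _ rfl, chiR_gamA_ar, seq_seq, act₂_seq rfl rfl, seq_one _ _ (of_cod _),
    counit_ar, hpi]

lemma DeltaR_ar {R : M} (p : W.JA ⟶ R) (i : R ⟶ W.JA) :
    of D (W.DeltaR R p i)
      = (of D i ⊡ (W.jj ⨾ of D p ⨾ of D i)) ⨾ W.act₂ (of D p) (of D p) := by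
  rw [DeltaR, of_eqToHom_comp]
  simp only [of_comp, of_buh, of_id]
  rw [chiR_gamA_ar, jeta_ar, ← seq_seq, ← seq_seq, ← one_b_seq _ rfl, ← b_seq (by simp) (by simp),
    one_seq _ _ (of_dom _), seq_seq]

/-- The unit-first comultiplication on a retract of `J∘A`. -/
lemma Delta_ar {R : M} (p : W.JA ⟶ R) (i : R ⟶ W.JA) :
    of D (eqToHom (D.buL R).symm ≫ D.buh W.jeta (𝟙 R) ≫ D.buh p (𝟙 R) ≫
      W.chiR R R (W.gamA R p i) (W.gamA R p i))
      = ((W.jj ⨾ of D p ⨾ of D i) ⊡ of D i) ⨾ W.act₂ (of D p) (of D p) := by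
  rw [of_eqToHom_comp]
  simp only [of_comp, of_buh, of_id]
  rw [chiR_gamA_ar, jeta_ar, ← seq_seq, ← seq_seq, ← b_one_seq _ rfl, ← b_seq (by simp) (by simp),
    one_seq _ _ (of_dom _), seq_seq]

lemma sqcapLbar_comp_sqcapR : W.sqcapLbar ≫ W.sqcapR = W.sqcapR :=
  of_injective (D := D) (by rw [of_comp, W.eeq_sqcapLbar.sqcapR, one_seq _ _ (of_dom _)])

lemma sqcapR_comp_sqcapLbar : W.sqcapR ≫ W.sqcapLbar = W.sqcapLbar :=
  of_injective (D := D) (by rw [of_comp, W.eeq_sqcapR.sqcapLbar, one_seq _ _ (of_dom _)])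

lemma sqcapLbar_comp_counit : W.sqcapLbar ≫ W.counit = W.counit :=
  of_injective (D := D)
    (by rw [of_comp, counit_ar, W.ee₀_of_ee (of_dom _) (of_cod _) W.sqcapLbar_ee])

variable {W} {R L : M} {p : W.JA ⟶ R} {i : R ⟶ W.JA} {pb : W.JA ⟶ L} {ib : L ⟶ W.JA}

lemma absorbs_sqcapLbar (hpib : pb ≫ ib = W.sqcapLbar) (hipb : ib ≫ pb = 𝟙 L) :
    W.Absorbs (of D pb) :=
  W.absorbs_of_retract hipb fun e => by rw [hpib]; exact e.sqcapLbar

lemma muR_comp (hpi : p ≫ i = W.sqcapR) (hpib : pb ≫ ib = W.sqcapLbar) (hipb : ib ≫ pb = 𝟙 L) :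
    W.muR R p i ≫ (i ≫ pb) = D.buh (i ≫ pb) (i ≫ pb) ≫
      W.chiR L L (W.gamA L pb ib) (W.gamA L pb ib) ≫ D.buh ib (𝟙 L) ≫
        D.buh W.counit (𝟙 L) ≫ eqToHom (D.buL L) := by
  have hc := absorbs_sqcapLbar hpib hipb
  have hp : of D p ⨾ of D (i ≫ pb) = of D pb := by
    rw [← of_comp, comp_splitting_of_comp hpi hpib hipb W.sqcapR_comp_sqcapLbar]
  have hb : of D (i ≫ pb) ⨾ of D ib = of D i ⨾ of D W.sqcapLbar := by
    rw [← of_comp, ← of_comp, Category.assoc, hpib]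
  have he : of D p ⨾ of D i ⨾ W.ee₀ = W.ee₀ := by
    rw [← seq_seq, ← of_comp, hpi, W.ee₀_of_ee rfl rfl W.sqcapR_ee]
  have heb : of D pb ⨾ of D ib ⨾ W.ee₀ = W.ee₀ := by
    rw [← seq_seq, ← of_comp, hpib, W.ee₀_of_ee rfl rfl W.sqcapLbar_ee]
  refine of_injective (D := D) ?_
  rw [of_comp, of_comp (D.buh _ _), W.muR_ar he, W.mu_ar heb, of_buh, ← seq_seq (_ ⊡ _),
    ← b_seq rfl rfl, hb, b_seq rfl rfl, seq_seq, seq_seq,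
    W.absorbs_ee₀.seq_act₂ hc W.eeq_sqcapLbar W.eeq_sqcapLbar, ← act₂_counit_comm hc,
    ← b_one (of D (i ≫ pb)), act₂_seq rfl rfl, hp,
    seq_one _ _ W.ee₀_cod]

lemma comp_Delta (hpi : p ≫ i = W.sqcapR) (hpib : pb ≫ ib = W.sqcapLbar)
    (hipb : ib ≫ pb = 𝟙 L) :
    (i ≫ pb) ≫ eqToHom (D.buL L).symm ≫ D.buh W.jeta (𝟙 L) ≫ D.buh pb (𝟙 L) ≫
      W.chiR L L (W.gamA L pb ib) (W.gamA L pb ib)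
      = W.DeltaR R p i ≫ D.buh (i ≫ pb) (i ≫ pb) := by
  have hc := absorbs_sqcapLbar hpib hipb
  have hp : of D p ⨾ of D (i ≫ pb) = of D pb := by
    rw [← of_comp, comp_splitting_of_comp hpi hpib hipb W.sqcapR_comp_sqcapLbar]
  have hb : of D (i ≫ pb) ⨾ of D ib = of D i ⨾ of D W.sqcapLbar := by
    rw [← of_comp, ← of_comp, Category.assoc, hpib]
  refine of_injective (D := D) ?_
  have hl : of D (i ≫ pb) ⨾ ((W.jj ⨾ of D pb ⨾ of D ib) ⊡ of D ib)
      = of D i ⨾ (W.jj ⊡ one D W.JA) ⨾ (of D W.sqcapLbar ⊡ of D W.sqcapLbar) := by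
    rw [seq_b_of_dom_left (by simp) rfl, hb, ← of_comp, hpib,
      ← b_seq (by simp) (by simp), one_seq _ _ (by simp), seq_b_of_dom_left (by simp) rfl]
  have hr : (of D i ⊡ (W.jj ⨾ of D p ⨾ of D i)) = of D i ⨾ (one D W.JA ⊡ W.jj) ⨾
      (one D W.JA ⊡ of D W.sqcapR) := by
    rw [← b_seq (by simp) (by simp), seq_b_of_dom_right (by simp) rfl, ← of_comp, hpi,
      one_seq _ _ (by simp), seq_one _ _ (by simp)]
  rw [of_comp, of_comp (W.DeltaR R p i), W.Delta_ar, W.DeltaR_ar, of_buh, ← seq_seq, hl, hr,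
    seq_seq, seq_seq, seq_seq, seq_seq, seq_seq, act₂_seq rfl rfl,
    hp, hc.seq_act₂ hc W.eeq_sqcapLbar W.eeq_sqcapLbar,
    hc.seq_act₂ hc eeq_one W.eeq_sqcapR, act₂_unit_comm hc hc]

end RWB

/-- **Statement 12.**  Let `A` be a weak bimonoid in a duoidal category with split
idempotents, with fixed splittings of `⊓^R_∘` through `R_∘` and of `⊓̄^L_∘` through
`L̄_∘`.  Then (i) `⊓^R_∘.⊓̄^L_∘ = ⊓^R_∘` and `⊓̄^L_∘.⊓^R_∘ = ⊓̄^L_∘`; (ii) hence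
`π̄^L_∘.ι^R_∘` and `π^R_∘.ῑ^L_∘` are mutually inverse isomorphisms `R_∘ ≅ L̄_∘`;
(iii) these isomorphisms are simultaneously morphisms of monoids and of comonoids
in `(M,•)` for the separable Frobenius structures of `R_∘` and `L̄_∘`. -/
theorem R_iso_Lbar
    {M : Type u} [Category.{v} M] (D : Duo M) (W : WBim D)
    (hsplit : SplitIdem M)
    (R : M) (p : W.toRWB.JA ⟶ R) (i : R ⟶ W.toRWB.JA)
    (hpi : p ≫ i = W.toRWB.sqcapR) (hip : i ≫ p = 𝟙 R)
    (Lb : M) (pb : W.toRWB.JA ⟶ Lb) (ib : Lb ⟶ W.toRWB.JA)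
    (hpib : pb ≫ ib = W.toRWB.sqcapLbar) (hipb : ib ≫ pb = 𝟙 Lb) :
    -- (i)
    (W.toRWB.sqcapLbar ≫ W.toRWB.sqcapR = W.toRWB.sqcapR ∧
      W.toRWB.sqcapR ≫ W.toRWB.sqcapLbar = W.toRWB.sqcapLbar) ∧
    -- (ii)
    ((i ≫ pb) ≫ (ib ≫ p) = 𝟙 R ∧ (ib ≫ p) ≫ (i ≫ pb) = 𝟙 Lb) ∧
    -- (iii):  `i ≫ pb : R_∘ ⟶ L̄_∘` is a morphism of monoids and of comonoids,
    -- where `L̄_∘` carries the `•`-reversed analogues of the structure of `R_∘`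
    (let muLb : D.bu Lb Lb ⟶ Lb :=
        W.toRWB.chiR Lb Lb (W.toRWB.gamA Lb pb ib) (W.toRWB.gamA Lb pb ib)
          ≫ D.buh ib (𝟙 Lb)
          ≫ D.buh (D.coh (𝟙 D.uJ) W.ep ≫ D.pw) (𝟙 Lb)
          ≫ eqToHom (D.buL Lb)
     let etaLb : D.uJ ⟶ Lb := W.toRWB.jeta ≫ pb
     let DeltaLb : Lb ⟶ D.bu Lb Lb :=
        eqToHom (D.buL Lb).symm
          ≫ D.buh W.toRWB.jeta (𝟙 Lb)
          ≫ D.buh pb (𝟙 Lb)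
          ≫ W.toRWB.chiR Lb Lb (W.toRWB.gamA Lb pb ib) (W.toRWB.gamA Lb pb ib)
     let epsLb : Lb ⟶ D.uJ := ib ≫ D.coh (𝟙 D.uJ) W.ep ≫ D.pw
     (W.toRWB.muR R p i ≫ (i ≫ pb) = D.buh (i ≫ pb) (i ≫ pb) ≫ muLb) ∧
     (W.toRWB.etaR R p ≫ (i ≫ pb) = etaLb) ∧
     ((i ≫ pb) ≫ DeltaLb = W.toRWB.DeltaR R p i ≫ D.buh (i ≫ pb) (i ≫ pb)) ∧
     ((i ≫ pb) ≫ epsLb = W.toRWB.epsR R i)) := by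
  have hp : p ≫ i ≫ pb = pb :=
    comp_splitting_of_comp hpi hpib hipb W.sqcapR_comp_sqcapLbar
  have hpb : pb ≫ ib ≫ p = p :=
    comp_splitting_of_comp hpib hpi hip W.sqcapLbar_comp_sqcapR
  refine ⟨⟨W.sqcapLbar_comp_sqcapR, W.sqcapR_comp_sqcapLbar⟩, ⟨?_, ?_⟩,
    RWB.muR_comp hpi hpib hipb, ?_, RWB.comp_Delta hpi hpib hipb, ?_⟩
  · rw [Category.assoc, hpb, hip]
  · rw [Category.assoc, hp, hipb]
  · change (W.jeta ≫ p) ≫ (i ≫ pb) = W.jeta ≫ pb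
    rw [Category.assoc, hp]
  · change (i ≫ pb) ≫ ib ≫ W.counit = i ≫ W.counit
    rw [Category.assoc, ← Category.assoc pb, hpib, RWB.sqcapLbar_comp_counit]
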